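/- Let φ : ℝ → ℝ be thrice differentiable with ‖φ'''‖_∞ < ∞, and let Z be standard Gaussian. Define the Stein solution f_φ(x) = e^{x²/2} ∫_{−∞}^x (φ(y) − E[φ(Z)]) e^{−y²/2} dy, which satisfies f_φ'(x) − x f_φ(x) = φ(x) − E[φ(Z)]. Then there is an explicit constant K (depending only on |φ'(0)|, |φ''(0)|, and ‖φ'''‖_∞; one may take K = max{ (3/2)|φ''(0)| + (‖φ'''‖_∞/3)(2√2/√π) , 2|φ'(0)| + ‖φ'''‖_∞/3 }) such that |f_φ'(x)| ≤ K · (1 + |x| + |x|² + |x|³) for every x ∈ ℝ. -/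

import Mathlib

open MeasureTheory ProbabilityTheory

lemma w_deriv (y : ℝ) : HasDerivAt (fun y : ℝ => Real.exp (-y^2/2)) (-y * Real.exp (-y^2/2)) y := by
  have h : HasDerivAt (fun y : ℝ => -y^2/2) (-y) y := by
    have := ((hasDerivAt_pow 2 y).neg).div_const 2
    refine this.congr_deriv ?_
    simp; ring
  exact h.exp.congr_deriv (by ring)

lemma pow_w_int (n : ℕ) : Integrable (fun y : ℝ => y^n * Real.exp (-y^2/2)) := by
  have h := integrable_rpow_mul_exp_neg_mul_sq (b := 1/2) (by norm_num) (s := n) 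
    (by have : (0:ℝ) ≤ n := n.cast_nonneg
        linarith)
  refine h.congr (Filter.Eventually.of_forall fun y => ?_)
  simp only [Real.rpow_natCast]
  congr 2; ring

lemma abs3_w_int : Integrable (fun y : ℝ => |y|^3 * Real.exp (-y^2/2)) := by
  refine (pow_w_int 3).norm.congr (Filter.Eventually.of_forall fun y => ?_)
  simp

/-- one Taylor step -/
lemma taylor_step (g g' : ℝ → ℝ) (hg : ∀ x, HasDerivAt g (g' x) x) (h0 : g 0 = 0) (C : ℝ) (n : ℕ)
    (hb : ∀ y, 0 ≤ y → |g' y| ≤ C * y^n) : ∀ y, 0 ≤ y → |g y| ≤ C/(n+1) * y^(n+1) := by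
  intro y hy
  have := image_norm_le_of_norm_deriv_right_le_deriv_boundary (a := 0) (b := y) (f := g) (f' := g')
    (B := fun y => C/(n+1) * y^(n+1)) (B' := fun y => C * y^n)
    (fun x _ => (hg x).continuousAt.continuousWithinAt) (fun x _ => (hg x).hasDerivWithinAt)
    (by simp [h0]) (fun x => by
      have := (hasDerivAt_pow (n+1) x).const_mul (C/(n+1))
      refine this.congr_deriv ?_
      have : (n:ℝ)+1 ≠ 0 := by positivity
      simp; field_simp) (fun x hx => hb x hx.1)
  exact this ⟨hy, le_rfl⟩

lemma taylor_pos (φ φ' φ'' φ''' : ℝ → ℝ)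
    (hφ1 : ∀ x, HasDerivAt φ (φ' x) x)
    (hφ2 : ∀ x, HasDerivAt φ' (φ'' x) x)
    (hφ3 : ∀ x, HasDerivAt φ'' (φ''' x) x)
    (B : ℝ) (hB : ∀ x, |φ''' x| ≤ B) (y : ℝ) (hy : 0 ≤ y) :
    |φ y - φ 0 - φ' 0 * y - φ'' 0 / 2 * y^2| ≤ B/6 * y^3 := by
  have h1 := taylor_step (fun y => φ'' y - φ'' 0) φ''' (fun x => (hφ3 x).sub_const _) (by simp) B 0
    (by simpa using fun y _ => hB y)
  have h2 := taylor_step (fun y => φ' y - φ' 0 - φ'' 0 * y) _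
    (fun x => ((hφ2 x).sub_const _).sub ((hasDerivAt_id x).const_mul _)) (by simp) _ 1
    (by simpa using h1)
  have h3 := taylor_step (fun y => φ y - φ 0 - φ' 0 * y - φ'' 0 / 2 * y^2) 
    (fun y => φ' y - φ' 0 - φ'' 0 * y)
    (fun x => by
      have := (((hφ1 x).sub_const (φ 0)).sub ((hasDerivAt_id x).const_mul (φ' 0))).sub
        ((hasDerivAt_pow 2 x).const_mul (φ'' 0 / 2))
      refine this.congr_deriv ?_
      simp; ring) (by simp) _ 2
    (by simpa using h2) y hy
  convert h3 using 1
  push_cast; ring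

lemma taylor_all (φ φ' φ'' φ''' : ℝ → ℝ)
    (hφ1 : ∀ x, HasDerivAt φ (φ' x) x)
    (hφ2 : ∀ x, HasDerivAt φ' (φ'' x) x)
    (hφ3 : ∀ x, HasDerivAt φ'' (φ''' x) x)
    (B : ℝ) (hB : ∀ x, |φ''' x| ≤ B) (y : ℝ) :
    |φ y - φ 0 - φ' 0 * y - φ'' 0 / 2 * y^2| ≤ B/6 * |y|^3 := by
  rcases le_total 0 y with hy | hy
  · rw [abs_of_nonneg hy]; exact taylor_pos φ φ' φ'' φ''' hφ1 hφ2 hφ3 B hB y hy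
  · have := taylor_pos (fun x => φ (-x)) (fun x => -φ' (-x)) (fun x => φ'' (-x)) (fun x => -φ''' (-x))
      (fun x => ((hφ1 (-x)).comp x (hasDerivAt_neg x)).congr_deriv (by simp))
      (fun x => ((hφ2 (-x)).comp x (hasDerivAt_neg x)).neg.congr_deriv (by simp))
      (fun x => ((hφ3 (-x)).comp x (hasDerivAt_neg x)).congr_deriv (by simp)) B
      (fun x => by simpa using hB (-x)) (-y) (by linarith)
    rw [abs_of_nonpos hy]
    convert this using 2
    simp

lemma tail_bound (h : ℝ → ℝ) (A C : ℝ) (hC : 0 ≤ C)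
    (hh : ∀ y, |h y| ≤ A * |y|^3 + C) (x : ℝ) (hx : 0 ≤ x) :
    |x * ∫ y in Set.Ioi x, h y * Real.exp (-y^2/2)| ≤ (A * x * (x^2+2) + C) * Real.exp (-x^2/2) := by
  have hd : ∀ y, HasDerivAt (fun y => -((A * x * (y^2+2) + C) * Real.exp (-y^2/2)))
      ((A * x * y^3 + C * y) * Real.exp (-y^2/2)) y := by
    intro y
    have := (((((hasDerivAt_pow 2 y).add_const 2).const_mul (A*x)).add_const C).mul (w_deriv y)).neg
    refine this.congr_deriv ?_
    simp; ring
  have hi : Integrable (fun y => (A * x * y^3 + C * y) * Real.exp (-y^2/2)) := by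
    refine (((pow_w_int 3).const_mul (A*x)).add ((pow_w_int 1).const_mul C)).congr
      (Filter.Eventually.of_forall fun y => ?_)
    simp; ring
  have hi2 : Integrable (fun y => -((A * x * (y^2+2) + C) * Real.exp (-y^2/2))) := by
    refine (((pow_w_int 2).const_mul (-(A*x))).add ((pow_w_int 0).const_mul (-(A*x*2+C)))).congr
      (Filter.Eventually.of_forall fun y => ?_)
    simp; ring
  have ht := tendsto_zero_of_hasDerivAt_of_integrableOn_Ioi (a := x) (fun y _ => hd y) hi.integrableOn
    hi2.integrableOn
  have hI := integral_Ioi_of_hasDerivAt_of_tendsto' (a := x) (fun y _ => hd y) hi.integrableOn ht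
  have e : (A * x * (x^2+2) + C) * Real.exp (-x^2/2) = 
     ∫ y in Set.Ioi x, (A * x * y^3 + C * y) * Real.exp (-y^2/2) := by rw [hI]; ring
  rw [e, ← integral_const_mul, ← Real.norm_eq_abs]
  refine norm_integral_le_of_norm_le hi.integrableOn ?_
  filter_upwards [ae_restrict_mem measurableSet_Ioi] with y hy
  have hy : x < y := hy
  rw [Real.norm_eq_abs, abs_mul, abs_mul, Real.abs_exp, abs_of_nonneg hx, ← mul_assoc]
  gcongr
  have := hh y
  rw [abs_of_nonneg (hx.trans hy.le)] at this
  nlinarith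

lemma abs3_integral : ∫ y : ℝ, |y|^3 * Real.exp (-y^2/2) = 4 := by
  have hd : ∀ y, HasDerivAt (fun y : ℝ => -((y^2+2) * Real.exp (-y^2/2)))
      (y^3 * Real.exp (-y^2/2)) y := by
    intro y
    have := (((hasDerivAt_pow 2 y).add_const 2).mul (w_deriv y)).neg
    refine this.congr_deriv ?_
    simp; ring
  have hi2 : Integrable (fun y : ℝ => -((y^2+2) * Real.exp (-y^2/2))) := by
    refine (((pow_w_int 2).const_mul (-1)).add ((pow_w_int 0).const_mul (-2))).congr
      (Filter.Eventually.of_forall fun y => ?_)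
    simp; ring
  have ht := tendsto_zero_of_hasDerivAt_of_integrableOn_Ioi (a := 0) (fun y _ => hd y)
    (pow_w_int 3).integrableOn hi2.integrableOn
  have hI := integral_Ioi_of_hasDerivAt_of_tendsto' (a := 0) (fun y _ => hd y)
    (pow_w_int 3).integrableOn ht
  have := integral_comp_abs (f := fun y : ℝ => y^3 * Real.exp (-y^2/2))
  simp only [sq_abs] at this
  rw [this, hI]; norm_num

lemma w_integral : ∫ y : ℝ, Real.exp (-y^2/2) = √(2 * Real.pi) := by
  have := integral_gaussian (1/2)
  rw [show 2 * Real.pi = Real.pi / (1/2) by ring, ← this]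
  congr; ext y; congr 1; ring

lemma gauss_eq (φ : ℝ → ℝ) : (∫ z, φ z ∂(gaussianReal 0 1)) * √(2 * Real.pi) =
    ∫ y : ℝ, φ y * Real.exp (-y^2/2) := by
  rw [integral_gaussianReal_eq_integral_smul (by norm_num), ← integral_mul_const]
  congr; ext y
  have : √(2 * Real.pi) ≠ 0 := by positivity
  simp only [gaussianPDFReal, smul_eq_mul]
  simp only [NNReal.coe_one, mul_one, sub_zero]
  field_simp

lemma iic_deriv (g : ℝ → ℝ) (hc : Continuous g) (hi : Integrable g) (x : ℝ) :
    HasDerivAt (fun x => ∫ y in Set.Iio x, g y) (g x) x := by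
  have e : (fun x => ∫ y in Set.Iio x, g y) =
      fun x => (∫ y in Set.Iic 0, g y) + ∫ y in (0:ℝ)..x, g y := by
    ext x
    rw [← integral_Iic_eq_integral_Iio,
      ← intervalIntegral.integral_Iic_sub_Iic hi.integrableOn hi.integrableOn]
    ring
  rw [e]
  exact (hc.integral_hasStrictDerivAt 0 x).hasDerivAt.const_add _

/-- Two-sided tail bound for a centred function. -/
lemma tail_bound_two (h : ℝ → ℝ) (A C : ℝ) (hC : 0 ≤ C)
    (hh : ∀ y, |h y| ≤ A * |y|^3 + C) (hi : Integrable (fun y => h y * Real.exp (-y^2/2)))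
    (h0 : ∫ y, h y * Real.exp (-y^2/2) = 0) (x : ℝ) :
    |x * ∫ y in Set.Iic x, h y * Real.exp (-y^2/2)| ≤
      (A * |x| * (|x|^2+2) + C) * Real.exp (-x^2/2) := by
  rcases le_total 0 x with hx | hx
  · have e := intervalIntegral.integral_Iic_add_Ioi (b := x) hi.integrableOn hi.integrableOn
    rw [h0] at e
    rw [eq_neg_of_add_eq_zero_left e, mul_neg, abs_neg, abs_of_nonneg hx]
    exact tail_bound h A C hC hh x hx
  · have := tail_bound (fun y => h (-y)) A C hC (fun y => by simpa using hh (-y)) (-x) (by linarith)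
    have e := integral_comp_neg_Iic x (fun y => h (-y) * Real.exp (-y^2/2))
    simp only [neg_neg, neg_sq] at e this
    rw [e, abs_of_nonpos hx]
    simpa using this

lemma poly_part (a b : ℝ) :
    Integrable (fun y : ℝ => (a * y + b / 2 * (y^2-1)) * Real.exp (-y^2/2)) ∧
    ∫ y : ℝ, (a * y + b / 2 * (y^2-1)) * Real.exp (-y^2/2) = 0 ∧
    ∀ x, ∫ y in Set.Iic x, (a * y + b / 2 * (y^2-1)) * Real.exp (-y^2/2) =
      -((a + b/2 * x) * Real.exp (-x^2/2)) := by
  have hd : ∀ y, HasDerivAt (fun y : ℝ => -((a + b/2 * y) * Real.exp (-y^2/2)))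
      ((a * y + b / 2 * (y^2-1)) * Real.exp (-y^2/2)) y := by
    intro y
    have := ((((hasDerivAt_id y).const_mul (b/2)).const_add a).mul (w_deriv y)).neg
    refine this.congr_deriv ?_
    simp; ring
  have hi : Integrable (fun y : ℝ => (a * y + b / 2 * (y^2-1)) * Real.exp (-y^2/2)) := by
    refine ((((pow_w_int 2).const_mul (b/2)).add ((pow_w_int 1).const_mul a)).add
      ((pow_w_int 0).const_mul (-(b/2)))).congr (Filter.Eventually.of_forall fun y => ?_)
    simp; ring
  have hi2 : Integrable (fun y : ℝ => -((a + b/2 * y) * Real.exp (-y^2/2))) := by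
    refine (((pow_w_int 1).const_mul (-(b/2))).add ((pow_w_int 0).const_mul (-a))).congr
      (Filter.Eventually.of_forall fun y => ?_)
    simp; ring
  refine ⟨hi, integral_eq_zero_of_hasDerivAt_of_integrable hd hi hi2, fun x => ?_⟩
  have ht := tendsto_zero_of_hasDerivAt_of_integrableOn_Iic (a := x) (fun y _ => hd y)
    hi.integrableOn hi2.integrableOn
  rw [integral_Iic_of_hasDerivAt_of_tendsto' (fun y _ => hd y) hi.integrableOn ht, sub_zero]

/-- Polynomial growth bound on the derivative of the Stein solution associated
with a thrice differentiable test function with bounded third derivative. -/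
theorem stein_solution_derivative_bound
    (φ φ' φ'' φ''' : ℝ → ℝ)
    (hφ1 : ∀ x, HasDerivAt φ (φ' x) x)
    (hφ2 : ∀ x, HasDerivAt φ' (φ'' x) x)
    (hφ3 : ∀ x, HasDerivAt φ'' (φ''' x) x)
    (B : ℝ) (hB : ∀ x, |φ''' x| ≤ B) :
    ∀ x : ℝ,
      |deriv (fun x => Real.exp (x ^ 2 / 2) *
          ∫ y in Set.Iio x,
            (φ y - ∫ z, φ z ∂(gaussianReal 0 1)) * Real.exp (-y ^ 2 / 2)) x|
        ≤ max ((3 / 2) * |φ'' 0| + (B / 3) * (2 * Real.sqrt 2 / Real.sqrt Real.pi))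
              (2 * |φ' 0| + B / 3)
          * (1 + |x| + |x| ^ 2 + |x| ^ 3) := by
  intro x
  have hB0 : 0 ≤ B := (abs_nonneg _).trans (hB 0)
  have hT := taylor_all φ φ' φ'' φ''' hφ1 hφ2 hφ3 B hB
  have hg := gauss_eq φ
  generalize (∫ z, φ z ∂(gaussianReal 0 1)) = c at hg ⊢
  have hφc : Continuous φ := continuous_iff_continuousAt.2 fun x => (hφ1 x).continuousAt
  obtain ⟨hPi, hP0, hPx⟩ := poly_part (φ' 0) (φ'' 0)
  generalize φ' 0 = a at *
  generalize φ'' 0 = b at *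
  obtain ⟨r, hr⟩ : ∃ r, r = c - φ 0 - b / 2 := ⟨_, rfl⟩
  obtain ⟨R, hR⟩ : ∃ R : ℝ → ℝ, R = fun y => φ y - φ 0 - a * y - b / 2 * y^2 := ⟨_, rfl⟩
  have hRb : ∀ y, |R y| ≤ B/6 * |y|^3 := by rw [hR]; exact hT
  have hRc : Continuous R := by rw [hR]; fun_prop
  have hbi : Integrable (fun y : ℝ => B/6 * (|y|^3 * Real.exp (-y^2/2))) := abs3_w_int.const_mul _
  have hRle : ∀ y, ‖R y * Real.exp (-y^2/2)‖ ≤ B/6 * (|y|^3 * Real.exp (-y^2/2)) := by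
    intro y
    rw [Real.norm_eq_abs, abs_mul, Real.abs_exp, ← mul_assoc]
    gcongr
    exact hRb y
  have hRi : Integrable (fun y => R y * Real.exp (-y^2/2)) :=
    hbi.mono' (by fun_prop) (Filter.Eventually.of_forall hRle)
  have hwi : Integrable (fun y : ℝ => Real.exp (-y^2/2)) := by simpa using pow_w_int 0
  have hhi : Integrable (fun y => (R y - r) * Real.exp (-y^2/2)) := by
    simp only [sub_mul]; exact hRi.sub (hwi.const_mul r)
  have hsplit : ∀ y, (φ y - c) * Real.exp (-y^2/2) =
      (a * y + b / 2 * (y^2-1)) * Real.exp (-y^2/2) + (R y - r) * Real.exp (-y^2/2) := by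
    intro y; rw [hR, hr]; ring
  have hgi : Integrable (fun y => (φ y - c) * Real.exp (-y^2/2)) := by
    simp only [hsplit]; exact hPi.add hhi
  have hg0 : ∫ y, (φ y - c) * Real.exp (-y^2/2) = 0 := by
    have hφi : Integrable (fun y => φ y * Real.exp (-y^2/2)) := by
      refine (hgi.add (hwi.const_mul c)).congr (Filter.Eventually.of_forall fun y => ?_)
      simp; ring
    simp only [sub_mul]
    rw [integral_sub hφi (hwi.const_mul c), integral_const_mul, w_integral, hg, sub_self]
  have hh0 : ∫ y, (R y - r) * Real.exp (-y^2/2) = 0 := by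
    simp only [hsplit] at hg0
    rw [integral_add hPi hhi, hP0, zero_add] at hg0
    exact hg0
  obtain ⟨m, hm⟩ : ∃ m, m = 2 * Real.sqrt 2 / Real.sqrt Real.pi := ⟨_, rfl⟩
  have hm0 : 0 ≤ m := by rw [hm]; positivity
  have hrb : |r| ≤ B/6 * m := by
    have h1 : r * √(2 * Real.pi) = ∫ y, R y * Real.exp (-y^2/2) := by
      simp only [sub_mul] at hh0
      rw [integral_sub hRi (hwi.const_mul r), integral_const_mul, w_integral] at hh0
      linarith
    have h2 := norm_integral_le_of_norm_le hbi (Filter.Eventually.of_forall hRle)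
    have hs : 0 < √(2 * Real.pi) := by positivity
    rw [← h1, integral_const_mul, abs3_integral, Real.norm_eq_abs, abs_mul, abs_of_pos hs] at h2
    have h4 : m * √(2 * Real.pi) = 4 := by
      have : √Real.pi ≠ 0 := by positivity
      rw [hm, Real.sqrt_mul (by norm_num)]
      field_simp
      norm_num
    refine le_of_mul_le_mul_right ?_ hs
    rw [mul_assoc, h4]; exact h2
  have htail := tail_bound_two (fun y => R y - r) (B/6) |r| (abs_nonneg r)
    (fun y => (abs_sub _ _).trans (by linarith [hRb y])) hhi hh0 x
  have hG := iic_deriv (fun y => (φ y - c) * Real.exp (-y^2/2)) (by fun_prop) hgi x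
  have hE : HasDerivAt (fun x : ℝ => Real.exp (x^2/2)) (x * Real.exp (x^2/2)) x := by
    have h : HasDerivAt (fun y : ℝ => y^2/2) x x :=
      ((hasDerivAt_pow 2 x).div_const 2).congr_deriv (by simp)
    exact h.exp.congr_deriv (by ring)
  have hval : ∫ y in Set.Iio x, (φ y - c) * Real.exp (-y^2/2) =
      -((a + b/2 * x) * Real.exp (-x^2/2)) + ∫ y in Set.Iic x, (R y - r) * Real.exp (-y^2/2) := by
    rw [← integral_Iic_eq_integral_Iio, ← hPx, ← integral_add hPi.integrableOn hhi.integrableOn]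
    simp only [hsplit]
  have hee : Real.exp (x^2/2) * Real.exp (-x^2/2) = 1 := by
    rw [← Real.exp_add]; simp [neg_div]
  have hder := (hE.mul hG).deriv
  simp only [hval] at hder
  refine (congrArg abs hder).trans_le ?_
  rw [← hm]
  generalize (∫ y in Set.Iic x, (R y - r) * Real.exp (-y^2/2)) = T at *
  have hfin : x * Real.exp (x^2/2) * (-((a + b/2 * x) * Real.exp (-x^2/2)) + T) +
      Real.exp (x^2/2) * ((φ x - c) * Real.exp (-x^2/2)) =
      -(b/2) + (R x - r) + Real.exp (x^2/2) * (x * T) := by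
    have : φ x - c = a * x + b/2 * (x^2-1) + (R x - r) := by rw [hR, hr]; ring
    rw [this]
    linear_combination (-(b/2) + (R x - r)) * hee
  rw [hfin]
  have h3 : |Real.exp (x^2/2) * (x * T)| ≤ B/6 * |x| * (|x|^2+2) + |r| := by
    rw [abs_mul, Real.abs_exp]
    calc _ ≤ Real.exp (x^2/2) * ((B/6 * |x| * (|x|^2+2) + |r|) * Real.exp (-x^2/2)) := by gcongr
      _ = _ := by linear_combination (B/6 * |x| * (|x|^2+2) + |r|) * hee
  have h4 := abs_add_le (-(b/2) + (R x - r)) (Real.exp (x^2/2) * (x * T))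
  have h5 := abs_add_le (-(b/2)) (R x - r)
  have h6 := abs_sub (R x) r
  have h7 := hRb x
  have h8 : |-(b/2)| = |b|/2 := by rw [abs_neg, abs_div]; norm_num
  set K := max ((3 / 2) * |b| + (B / 3) * m) (2 * |a| + B / 3) with hK
  have k1 : (3 / 2) * |b| + (B / 3) * m ≤ K := le_max_left _ _
  have k2 : 2 * |a| + B / 3 ≤ K := le_max_right _ _
  have k3 : B/3 ≤ K := by linarith [abs_nonneg a]
  have hx0 := abs_nonneg x
  have k4 : B/3 * |x| ≤ K * |x| := by gcongr
  have k5 : B/3 * |x|^3 ≤ K * |x|^3 := by gcongr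
  have k6 : 0 ≤ K * |x|^2 := mul_nonneg (by linarith) (by positivity)
  have := abs_nonneg b
  nlinarith
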